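/- There exists an increasing function α : ℝ≥0 → ℝ≥0 (depending only on the dimension n) with the following property: for every ε > 0 and every f, φ, t_f, u, G as in the context such that the control u satisfies the approximation constraint α(∫₀^{t_f} φ(‖u(s)‖) ds) · ∫₀^{t_f} φ(‖u(s)‖) ‖P̂(s)‖ ds ≤ ε, every true moment flow (μ_t) for (f,G,u) with mean m and covariance P and its statistical linearization (m̂,P̂), both defined on all of [0,t_f] and with the same initial mean and covariance, satisfy sup_{t∈[0,t_f]} ‖m(t) − m̂(t)‖² + sup_{t∈[0,t_f]} ‖P(t) − P̂(t)‖ ≤ ε. -/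

import Mathlib

open MeasureTheory intervalIntegral ContinuousLinearMap
open scoped RealInnerProductSpace NNReal

open Set Filter Topology in
theorem LipschitzOnWith.comp_absolutelyContinuousOnInterval {X Y : Type*}
    [PseudoMetricSpace X] [PseudoMetricSpace Y] {g : X → Y} {f : ℝ → X} {K : ℝ≥0} {s : Set X}
    {a b : ℝ} (hg : LipschitzOnWith K g s) (hf : AbsolutelyContinuousOnInterval f a b)
    (hs : MapsTo f (uIcc a b) s) : AbsolutelyContinuousOnInterval (g ∘ f) a b := by
  have h := Tendsto.const_mul (K : ℝ) hf
  rw [mul_zero] at h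
  refine squeeze_zero' (.of_forall fun E => Finset.sum_nonneg fun i _ => dist_nonneg) ?_ h
  filter_upwards [mem_inf_of_right (mem_principal_self _)] with E hE
  rw [Finset.mul_sum]
  exact Finset.sum_le_sum fun i hi =>
    hg.dist_le_mul _ (hs (hE.1 i hi).1) _ (hs (hE.1 i hi).2)

open Set Filter in
/-- **Grönwall's inequality** in integral form, with an integrable coefficient. -/
theorem le_mul_exp_integral_of_le_add_integral {a y : ℝ → ℝ} {b T : ℝ}
    (ha : IntervalIntegrable a volume 0 T) (ha0 : ∀ s, 0 ≤ a s)
    (hy : ContinuousOn y (Icc 0 T))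
    (hle : ∀ t ∈ Icc 0 T, y t ≤ b + ∫ s in (0:ℝ)..t, a s * y s) :
    ∀ t ∈ Icc 0 T, y t ≤ b * Real.exp (∫ s in (0:ℝ)..t, a s) := by
  intro t ht
  have hsub : uIcc 0 t ⊆ uIcc 0 T := by
    rw [uIcc_of_le ht.1, uIcc_of_le (ht.1.trans ht.2)]
    exact Icc_subset_Icc_right ht.2
  have hsub' : uIcc 0 t ⊆ Icc 0 T := by rwa [uIcc_of_le (ht.1.trans ht.2)] at hsub
  have hat : IntervalIntegrable a volume 0 t := ha.mono_set hsub
  have hay : IntervalIntegrable (fun s => a s * y s) volume 0 t :=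
    hat.mul_continuousOn (hy.mono hsub')
  set A : ℝ → ℝ := fun x => ∫ s in (0:ℝ)..x, a s with hA
  set Z : ℝ → ℝ := fun x => b + ∫ s in (0:ℝ)..x, a s * y s with hZ
  have hAac : AbsolutelyContinuousOnInterval A 0 t :=
    hat.absolutelyContinuousOnInterval_intervalIntegral left_mem_uIcc
  have hZac : AbsolutelyContinuousOnInterval Z 0 t :=
    (LipschitzWith.const b).lipschitzOnWith.absolutelyContinuousOnInterval.fun_add
      (hay.absolutelyContinuousOnInterval_intervalIntegral left_mem_uIcc)
  have hWac : AbsolutelyContinuousOnInterval (fun x => Real.exp (-A x)) 0 t := by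
    obtain ⟨C, hC⟩ := hAac.exists_bound
    obtain ⟨K, hK⟩ := (ContDiff.contDiffOn (s := Icc (-C) C) (n := 1)
      (f := fun x => Real.exp (-x)) (by fun_prop)).exists_lipschitzOnWith (by decide)
      (convex_Icc _ _) isCompact_Icc
    exact hK.comp_absolutelyContinuousOnInterval hAac fun x hx => abs_le.1 (hC x hx)
  have hint := (hWac.fun_mul hZac).integral_deriv_eq_sub
  have hnonpos : ∫ x in (0:ℝ)..t, deriv (fun x => Real.exp (-A x) * Z x) x ≤ 0 := by
    rw [integral_of_le ht.1]
    refine setIntegral_nonpos_ae measurableSet_Ioc ?_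
    filter_upwards [hat.ae_hasDerivAt_integral, hay.ae_hasDerivAt_integral] with x h1 h2 hx
    have hx' : x ∈ uIcc 0 t := by rw [uIcc_of_le ht.1]; exact Ioc_subset_Icc_self hx
    have d1 : HasDerivAt A (a x) x := h1 hx' 0 left_mem_uIcc
    have d2 : HasDerivAt Z (a x * y x) x := (h2 hx' 0 left_mem_uIcc).const_add b
    rw [(d1.fun_neg.exp.fun_mul d2).deriv]
    have hyx : y x ≤ Z x := hle x (hsub' hx')
    have : 0 ≤ Real.exp (-A x) * (a x * (Z x - y x)) :=
      mul_nonneg (Real.exp_pos _).le (mul_nonneg (ha0 x) (sub_nonneg.2 hyx))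
    linarith
  have hA0 : A 0 = 0 := integral_same
  have hZ0 : Z 0 = b := by simp [hZ]
  rw [hint, hA0, hZ0, neg_zero, Real.exp_zero, one_mul, sub_nonpos, Real.exp_neg,
    inv_mul_le_iff₀ (Real.exp_pos _)] at hnonpos
  calc y t ≤ Z t := hle t ht
    _ ≤ _ := by rwa [mul_comm]

open Set in
/-- **Grönwall's inequality** for a vector-valued primitive starting at zero. -/
theorem norm_le_integral_mul_exp_of_norm_deriv_le {E : Type*} [NormedAddCommGroup E]
    [NormedSpace ℝ E] {X h : ℝ → E} {a c : ℝ → ℝ} {T : ℝ}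
    (hh : IntervalIntegrable h volume 0 T)
    (hX : ∀ t ∈ Icc 0 T, X t = ∫ s in (0:ℝ)..t, h s)
    (ha : IntervalIntegrable a volume 0 T) (ha0 : ∀ s, 0 ≤ a s)
    (hc : IntervalIntegrable c volume 0 T) (hc0 : ∀ s, 0 ≤ c s)
    (hle : ∀ t ∈ Icc 0 T, ‖h t‖ ≤ a t * ‖X t‖ + c t) :
    ∀ t ∈ Icc 0 T, ‖X t‖ ≤ (∫ s in (0:ℝ)..T, c s) * Real.exp (∫ s in (0:ℝ)..T, a s) := by
  intro t ht
  have hT : 0 ≤ T := ht.1.trans ht.2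
  have hXc : ContinuousOn X (Icc 0 T) := by
    have := continuousOn_primitive_interval' hh left_mem_uIcc
    rw [uIcc_of_le hT] at this
    exact this.congr hX
  have haX : IntervalIntegrable (fun s => a s * ‖X s‖) volume 0 T :=
    ha.mul_continuousOn (by rw [uIcc_of_le hT]; exact hXc.norm)
  have hmono {g : ℝ → ℝ} (hg : IntervalIntegrable g volume 0 T) (hg0 : ∀ s, 0 ≤ g s) {r : ℝ}
      (hr : r ∈ Icc 0 T) : ∫ s in (0:ℝ)..r, g s ≤ ∫ s in (0:ℝ)..T, g s :=
    integral_mono_interval le_rfl hr.1 hr.2 (.of_forall hg0) hg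
  refine (le_mul_exp_integral_of_le_add_integral (b := ∫ s in (0:ℝ)..T, c s) ha ha0 hXc.norm
    (fun r hr => ?_) t ht).trans ?_
  · have hsub : uIcc 0 r ⊆ uIcc 0 T := by
      rw [uIcc_of_le hr.1, uIcc_of_le hT]
      exact Icc_subset_Icc_right hr.2
    rw [hX r hr]
    refine (norm_integral_le_of_norm_le hr.1 (.of_forall fun s hs =>
      hle s ⟨hs.1.le, hs.2.trans hr.2⟩) ((haX.add hc).mono_set hsub)).trans ?_
    rw [integral_add (haX.mono_set hsub) (hc.mono_set hsub), add_comm]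
    gcongr
    exact hmono hc hc0 hr
  · gcongr
    · exact integral_nonneg hT fun s _ => hc0 s
    · exact hmono ha ha0 ht

theorem sq_integral_mul_le {Ω : Type*} [MeasurableSpace Ω] {ν : Measure Ω} {q a : Ω → ℝ}
    (hq0 : ∀ x, 0 ≤ q x) (hq : Integrable q ν) (hqa : Integrable (fun x => q x * a x) ν)
    (hqa2 : Integrable (fun x => q x * a x ^ 2) ν) :
    (∫ x, q x * a x ∂ν) ^ 2 ≤ (∫ x, q x ∂ν) * ∫ x, q x * a x ^ 2 ∂ν := by
  have key (c : ℝ) : 0 ≤ (∫ x, q x ∂ν) * (c * c) + (-2 * ∫ x, q x * a x ∂ν) * c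
      + ∫ x, q x * a x ^ 2 ∂ν := by
    have h : 0 ≤ ∫ x, (q x * a x ^ 2 - 2 * c * (q x * a x) + c * c * q x) ∂ν :=
      integral_nonneg fun x => by
        have := mul_nonneg (hq0 x) (sq_nonneg (a x - c))
        simp only [Pi.zero_apply]
        linarith
    rw [MeasureTheory.integral_add (by exact hqa2.sub (hqa.const_mul _)) (hq.const_mul _),
      MeasureTheory.integral_sub hqa2 (hqa.const_mul _), MeasureTheory.integral_const_mul,
      MeasureTheory.integral_const_mul] at h
    linarith
  have := discrim_le_zero key
  rw [discrim] at this
  linarith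

section Moments

variable {n : ℕ} {μ : Measure (EuclideanSpace ℝ (Fin n))} [IsProbabilityMeasure μ]
  {m : EuclideanSpace ℝ (Fin n)} {P : EuclideanSpace ℝ (Fin n) →L[ℝ] EuclideanSpace ℝ (Fin n)}
  {g : EuclideanSpace ℝ (Fin n) → EuclideanSpace ℝ (Fin n)} {L : ℝ}

theorem integrable_norm_sub_sq (h2 : Integrable (fun x => ‖x‖ ^ 2) μ)
    (m : EuclideanSpace ℝ (Fin n)) : Integrable (fun x => ‖x - m‖ ^ 2) μ := by
  refine ((h2.const_mul 2).add (integrable_const (2 * ‖m‖ ^ 2))).mono'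
    (Continuous.aestronglyMeasurable (by fun_prop)) (.of_forall fun x => ?_)
  rw [Real.norm_of_nonneg (by positivity)]
  have h := norm_sub_le x m
  simp only [Pi.add_apply]
  nlinarith [norm_nonneg (x - m), sq_nonneg (‖x‖ - ‖m‖)]

theorem integrable_inner_smul (h2 : Integrable (fun x => ‖x‖ ^ 2) μ)
    (hg : AEStronglyMeasurable g μ) (hL : ∀ x, ‖g x‖ ≤ L * ‖x - m‖)
    (w : EuclideanSpace ℝ (Fin n)) :
    Integrable (fun x => ⟪x - m, w⟫ • g x) μ := by
  refine ((integrable_norm_sub_sq h2 m).const_mul (L * ‖w‖)).mono'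
    (.smul (f := fun x => ⟪x - m, w⟫) (Continuous.aestronglyMeasurable (by fun_prop)) hg)
    (.of_forall fun x => ?_)
  calc ‖⟪x - m, w⟫ • g x‖ = ‖⟪x - m, w⟫‖ * ‖g x‖ := norm_smul _ _
    _ ≤ (‖x - m‖ * ‖w‖) * (L * ‖x - m‖) := by
      gcongr
      · exact norm_inner_le_norm _ _
      · exact hL x
    _ = L * ‖w‖ * ‖x - m‖ ^ 2 := by ring

theorem integral_norm_sub_sq_le (h2 : Integrable (fun x => ‖x‖ ^ 2) μ)
    (hP : ∀ w, P w = ∫ x, ⟪x - m, w⟫ • (x - m) ∂μ) :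
    ∫ x, ‖x - m‖ ^ 2 ∂μ ≤ n * ‖P‖ := by
  let e := EuclideanSpace.basisFun (Fin n) ℝ
  have hint (w) : Integrable (fun x => ⟪x - m, w⟫ • (x - m)) μ :=
    integrable_inner_smul (L := 1) h2 (by fun_prop) (by simp) w
  have hpt (x : EuclideanSpace ℝ (Fin n)) :
      ‖x - m‖ ^ 2 = ∑ i, ⟪e i, ⟪x - m, e i⟫ • (x - m)⟫ := by
    rw [← e.sum_sq_norm_inner_left (x - m)]
    refine Finset.sum_congr rfl fun i _ => ?_
    rw [real_inner_smul_right, real_inner_comm, Real.norm_eq_abs, sq_abs, sq]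
  simp_rw [hpt]
  rw [MeasureTheory.integral_finsetSum _ fun i _ => (hint (e i)).const_inner _]
  calc ∑ i, ∫ x, ⟪e i, ⟪x - m, e i⟫ • (x - m)⟫ ∂μ = ∑ i, ⟪e i, P (e i)⟫ := by
        refine Finset.sum_congr rfl fun i _ => ?_
        rw [integral_inner (hint (e i)), hP]
    _ ≤ ∑ _i : Fin n, ‖P‖ := by
        refine Finset.sum_le_sum fun i _ => (real_inner_le_norm _ _).trans ?_
        simpa using P.le_opNorm (e i)
    _ = n * ‖P‖ := by simp

theorem norm_integral_sub_le (h1 : Integrable (fun x => x) μ)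
    (h2 : Integrable (fun x => ‖x‖ ^ 2) μ)
    (hP : ∀ w, P w = ∫ x, ⟪x - m, w⟫ • (x - m) ∂μ) (hg : Integrable g μ) (hL0 : 0 ≤ L)
    (hL : ∀ x, ‖g x - g m‖ ≤ L * ‖x - m‖) :
    ‖∫ x, g x ∂μ - g m‖ ≤ L * √(n * ‖P‖) := by
  have h1' : Integrable (fun x => ‖x - m‖) μ := (h1.sub (integrable_const m)).norm
  have hcs := sq_integral_mul_le (ν := μ) (q := fun _ => 1) (a := fun x => ‖x - m‖)
    (fun _ => zero_le_one) (integrable_const 1) (by simpa using h1')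
    (by simpa using integrable_norm_sub_sq h2 m)
  simp only [one_mul, MeasureTheory.integral_const, probReal_univ, smul_eq_mul] at hcs
  calc ‖∫ x, g x ∂μ - g m‖ = ‖∫ x, (g x - g m) ∂μ‖ := by
        rw [integral_sub hg (integrable_const _)]; simp
    _ ≤ ∫ x, L * ‖x - m‖ ∂μ :=
        MeasureTheory.norm_integral_le_of_norm_le (h1'.const_mul L) (.of_forall hL)
    _ = L * ∫ x, ‖x - m‖ ∂μ := integral_const_mul _ _
    _ ≤ L * √(n * ‖P‖) := by
        gcongr
        exact Real.le_sqrt_of_sq_le (hcs.trans (integral_norm_sub_sq_le h2 hP))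

theorem norm_integral_inner_smul_add_le (h1 : Integrable (fun x => x) μ)
    (h2 : Integrable (fun x => ‖x‖ ^ 2) μ) (hm : m = ∫ x, x ∂μ)
    (hP : ∀ w, P w = ∫ x, ⟪x - m, w⟫ • (x - m) ∂μ) (hg : Integrable g μ) (hL0 : 0 ≤ L)
    (hL : ∀ x, ‖g x - g m‖ ≤ L * ‖x - m‖) (w : EuclideanSpace ℝ (Fin n)) :
    ‖∫ x, (⟪x - m, w⟫ • g x + ⟪g x, w⟫ • (x - m)) ∂μ‖ ≤ 2 * n * L * ‖P‖ * ‖w‖ := by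
  have hsub : Integrable (fun x => x - m) μ := h1.sub (integrable_const m)
  have hzero : ∫ x, (x - m) ∂μ = 0 := by
    rw [integral_sub h1 (integrable_const m), ← hm]; simp
  have hzero' : ∫ x, ⟪x - m, w⟫ ∂μ = 0 := by
    simp_rw [real_inner_comm w]
    rw [integral_inner hsub, hzero, inner_zero_right]
  have hbound (x) : ‖⟪x - m, w⟫ • (g x - g m) + ⟪g x - g m, w⟫ • (x - m)‖
      ≤ 2 * L * ‖w‖ * ‖x - m‖ ^ 2 := by
    refine (norm_add_le _ _).trans ?_
    rw [norm_smul, norm_smul]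
    calc _ ≤ (‖x - m‖ * ‖w‖) * (L * ‖x - m‖) + ((L * ‖x - m‖) * ‖w‖) * ‖x - m‖ := by
          gcongr
          · exact norm_inner_le_norm _ _
          · exact hL x
          · refine (norm_inner_le_norm _ _).trans ?_
            gcongr
            exact hL x
      _ = _ := by ring
  have hintb : Integrable (fun x => 2 * L * ‖w‖ * ‖x - m‖ ^ 2) μ :=
    (integrable_norm_sub_sq h2 m).const_mul _
  have hint : Integrable
      (fun x => ⟪x - m, w⟫ • (g x - g m) + ⟪g x - g m, w⟫ • (x - m)) μ := by
    refine hintb.mono' ?_ (.of_forall hbound)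
    have hgm := hg.aestronglyMeasurable
    fun_prop
  have hi1 : Integrable (fun x => ⟪x - m, w⟫ • g m) μ := (hsub.inner_const w).smul_const _
  have hi2 : Integrable (fun x => ⟪g m, w⟫ • (x - m)) μ :=
    hsub.smul ⟪g m, w⟫
  have heq : ∫ x, (⟪x - m, w⟫ • g x + ⟪g x, w⟫ • (x - m)) ∂μ
      = ∫ x, (⟪x - m, w⟫ • (g x - g m) + ⟪g x - g m, w⟫ • (x - m)) ∂μ := by
    have : (fun x => ⟪x - m, w⟫ • g x + ⟪g x, w⟫ • (x - m)) = fun x =>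
        (⟪x - m, w⟫ • (g x - g m) + ⟪g x - g m, w⟫ • (x - m))
          + (⟪x - m, w⟫ • g m + ⟪g m, w⟫ • (x - m)) := by
      funext x
      have hx := inner_sub_left (𝕜 := ℝ) (g x) (g m) w
      rw [sub_eq_iff_eq_add.1 hx.symm]
      module
    rw [this, MeasureTheory.integral_add hint (by exact hi1.add hi2),
      MeasureTheory.integral_add hi1 hi2, _root_.integral_smul_const, hzero',
      MeasureTheory.integral_smul, hzero]
    simp
  rw [heq]
  calc _ ≤ ∫ x, 2 * L * ‖w‖ * ‖x - m‖ ^ 2 ∂μ :=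
        MeasureTheory.norm_integral_le_of_norm_le hintb (.of_forall hbound)
    _ = 2 * L * ‖w‖ * ∫ x, ‖x - m‖ ^ 2 ∂μ := integral_const_mul _ _
    _ ≤ 2 * L * ‖w‖ * (n * ‖P‖) := by
        gcongr
        exact integral_norm_sub_sq_le h2 hP
    _ = _ := by ring

end Moments

theorem approximation_constraint_accuracy (n : ℕ) :
    ∃ α : ℝ≥0 → ℝ≥0, Monotone α ∧
      ∀ ε : ℝ, 0 < ε →
      ∀ (k d : ℕ)
        (f : EuclideanSpace ℝ (Fin n) → EuclideanSpace ℝ (Fin k) → EuclideanSpace ℝ (Fin n))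
        (φ : ℝ≥0 → ℝ≥0) (t_f : ℝ) (u : ℝ → EuclideanSpace ℝ (Fin k))
        (G : EuclideanSpace ℝ (Fin k) →
          (EuclideanSpace ℝ (Fin d) →L[ℝ] EuclideanSpace ℝ (Fin n)))
        (μ : ℝ → Measure (EuclideanSpace ℝ (Fin n)))
        (m mhat : ℝ → EuclideanSpace ℝ (Fin n))
        (P Phat Ψ : ℝ → EuclideanSpace ℝ (Fin n) →L[ℝ] EuclideanSpace ℝ (Fin n)),
        (∀ v, ContDiff ℝ 1 (fun x => f x v)) →
        Continuous φ →
        (∀ x v, ‖fderiv ℝ (fun y => f y v) x‖ ≤ φ ‖v‖₊) →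
        0 < t_f →
        Measurable u →
        IntervalIntegrable (fun s => (φ ‖u s‖₊ : ℝ)) volume 0 t_f →
        (∀ w, Measurable fun v => G v w) →
        (∀ t ∈ Set.Icc 0 t_f, IsProbabilityMeasure (μ t)) →
        (∀ t ∈ Set.Icc 0 t_f, Integrable (fun x => ‖x‖ ^ 2) (μ t)) →
        (∀ t ∈ Set.Icc 0 t_f, Integrable (fun x : EuclideanSpace ℝ (Fin n) => x) (μ t)) →
        (∀ t ∈ Set.Icc 0 t_f, m t = ∫ x, x ∂(μ t)) →
        (∀ t ∈ Set.Icc 0 t_f, ∀ w, P t w = ∫ x, ⟪x - m t, w⟫ • (x - m t) ∂(μ t)) →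
        (∀ t ∈ Set.Icc 0 t_f, Integrable (fun x => f x (u t)) (μ t)) →
        IntervalIntegrable (fun s => ∫ x, f x (u s) ∂(μ s)) volume 0 t_f →
        (∀ t ∈ Set.Icc 0 t_f, m t = m 0 + ∫ s in (0:ℝ)..t, ∫ x, f x (u s) ∂(μ s)) →
        (∀ t ∈ Set.Icc 0 t_f, ∀ w, Ψ t w =
          (∫ x, (⟪x - m t, w⟫ • f x (u t) + ⟪f x (u t), w⟫ • (x - m t)) ∂(μ t))
            + (G (u t) ∘L adjoint (G (u t))) w) →
        IntervalIntegrable Ψ volume 0 t_f →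
        (∀ t ∈ Set.Icc 0 t_f, P t = P 0 + ∫ s in (0:ℝ)..t, Ψ s) →
        mhat 0 = m 0 →
        Phat 0 = P 0 →
        IntervalIntegrable (fun s => f (mhat s) (u s)) volume 0 t_f →
        (∀ t ∈ Set.Icc 0 t_f, mhat t = m 0 + ∫ s in (0:ℝ)..t, f (mhat s) (u s)) →
        IntervalIntegrable (fun s =>
          fderiv ℝ (fun y => f y (u s)) (mhat s) ∘L Phat s
            + Phat s ∘L adjoint (fderiv ℝ (fun y => f y (u s)) (mhat s))
            + G (u s) ∘L adjoint (G (u s))) volume 0 t_f →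
        (∀ t ∈ Set.Icc 0 t_f, Phat t = P 0 + ∫ s in (0:ℝ)..t,
          (fderiv ℝ (fun y => f y (u s)) (mhat s) ∘L Phat s
            + Phat s ∘L adjoint (fderiv ℝ (fun y => f y (u s)) (mhat s))
            + G (u s) ∘L adjoint (G (u s)))) →
        -- the approximation constraint on the control
        (α (∫ s in (0:ℝ)..t_f, (φ ‖u s‖₊ : ℝ)).toNNReal : ℝ) *
            (∫ s in (0:ℝ)..t_f, (φ ‖u s‖₊ : ℝ) * ‖Phat s‖) ≤ ε →
        -- conclusion
        ∀ t₁ ∈ Set.Icc 0 t_f, ∀ t₂ ∈ Set.Icc 0 t_f,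
          ‖m t₁ - mhat t₁‖ ^ 2 + ‖P t₂ - Phat t₂‖ ≤ ε := by
  refine ⟨fun r => ((2 * n + 2) * Real.exp (2 * n * r) + n * r * Real.exp r ^ 2 *
    (1 + r * ((2 * n + 2) * Real.exp (2 * n * r))) : ℝ).toNNReal, fun r s hrs => ?_, ?_⟩
  · have hrs' : (r : ℝ) ≤ s := hrs
    dsimp only
    gcongr
  intro ε hε k d f φ t_f u G μ m mhat P Phat Ψ hf hφ hfφ htf hu hq hG hμ h2 h1 hm hP hfi
    hmi hm' hΨ hΨi hP' hm0 hP0 hmhi hmh' hPhi hPh' hα t₁ ht₁ t₂ ht₂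
  have hT : (0:ℝ) ≤ t_f := htf.le
  set q : ℝ → ℝ := fun s => (φ ‖u s‖₊ : ℝ) with hqdef
  have hq0 (s) : 0 ≤ q s := NNReal.coe_nonneg _
  have hlip (s) (x y) : ‖f x (u s) - f y (u s)‖ ≤ q s * ‖x - y‖ :=
    convex_univ.norm_image_sub_le_of_norm_fderiv_le
      (fun z _ => ((hf (u s)).differentiable one_ne_zero).differentiableAt)
      (fun z _ => hfφ z (u s)) (Set.mem_univ _) (Set.mem_univ _)
  have hcont {F : Type} [NormedAddCommGroup F] [NormedSpace ℝ F] {X h : ℝ → F} {X0 : F}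
      (hh : IntervalIntegrable h volume 0 t_f)
      (hX : ∀ t ∈ Set.Icc 0 t_f, X t = X0 + ∫ s in (0:ℝ)..t, h s) : ContinuousOn X (Set.uIcc 0 t_f) := by
    rw [Set.uIcc_of_le hT]
    have := continuousOn_primitive_interval' hh Set.left_mem_uIcc
    rw [Set.uIcc_of_le hT] at this
    exact (continuousOn_const.add this).congr hX
  have hdiff {F : Type} [NormedAddCommGroup F] [NormedSpace ℝ F] {X Y h k : ℝ → F} {X0 : F}
      (hh : IntervalIntegrable h volume 0 t_f) (hk : IntervalIntegrable k volume 0 t_f)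
      (hX : ∀ t ∈ Set.Icc 0 t_f, X t = X0 + ∫ s in (0:ℝ)..t, h s)
      (hY : ∀ t ∈ Set.Icc 0 t_f, Y t = X0 + ∫ s in (0:ℝ)..t, k s) (t) (ht : t ∈ Set.Icc 0 t_f) :
      X t - Y t = ∫ s in (0:ℝ)..t, (h s - k s) := by
    have hsub : Set.uIcc 0 t ⊆ Set.uIcc 0 t_f := by
      rw [Set.uIcc_of_le ht.1, Set.uIcc_of_le hT]
      exact Set.Icc_subset_Icc_right ht.2
    rw [integral_sub (hh.mono_set hsub) (hk.mono_set hsub), hX t ht, hY t ht]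
    abel
  have hPc := hcont hΨi hP'
  have hPhc := hcont hPhi hPh'
  have hqP : IntervalIntegrable (fun s => q s * ‖P s‖) volume 0 t_f :=
    hq.mul_continuousOn hPc.norm
  have hqPh : IntervalIntegrable (fun s => q s * ‖Phat s‖) volume 0 t_f :=
    hq.mul_continuousOn hPhc.norm
  have hqS : IntervalIntegrable (fun s => q s * √(n * ‖P s‖)) volume 0 t_f :=
    hq.mul_continuousOn (continuousOn_const.mul hPc.norm).sqrt
  set I := ∫ s in (0:ℝ)..t_f, q s with hI
  set J := ∫ s in (0:ℝ)..t_f, q s * ‖Phat s‖ with hJ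
  set S := ∫ s in (0:ℝ)..t_f, q s * √(n * ‖P s‖) with hS
  have hI0 : 0 ≤ I := integral_nonneg hT fun s _ => hq0 s
  have hJ0 : 0 ≤ J := integral_nonneg hT fun s _ => mul_nonneg (hq0 s) (norm_nonneg _)
  have hS0 : 0 ≤ S := integral_nonneg hT fun s _ => mul_nonneg (hq0 s) (Real.sqrt_nonneg _)
  have hcov : ∀ t ∈ Set.Icc 0 t_f, ‖P t - Phat t‖ ≤ (2 * n + 2) * J * Real.exp (2 * n * I) := by
    have := norm_le_integral_mul_exp_of_norm_deriv_le (hΨi.sub hPhi)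
      (hdiff hΨi hPhi hP' hPh') (hq.const_mul (2 * n)) (fun s => mul_nonneg (by positivity) (hq0 s))
      (hqPh.const_mul (2 * n + 2))
      (fun s => mul_nonneg (by positivity) (mul_nonneg (hq0 s) (norm_nonneg _))) (fun t ht => ?_)
    · rwa [intervalIntegral.integral_const_mul, intervalIntegral.integral_const_mul] at this
    have := hμ t ht
    set A := fderiv ℝ (fun y => f y (u t)) (mhat t)
    have hA : ‖A‖ ≤ q t := hfφ _ _
    have hmom : ‖Ψ t - G (u t) ∘L adjoint (G (u t))‖ ≤ 2 * n * q t * ‖P t‖ := by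
      refine opNorm_le_bound _ (mul_nonneg (mul_nonneg (by positivity) (hq0 t)) (norm_nonneg _))
        fun w => ?_
      rw [sub_apply, hΨ t ht w, add_sub_cancel_right]
      exact norm_integral_inner_smul_add_le (h1 t ht) (h2 t ht) (hm t ht) (hP t ht) (hfi t ht)
        (hq0 t) (fun x => hlip t x (m t)) w
    have hsplit : Ψ t - (A ∘L Phat t + Phat t ∘L adjoint A + G (u t) ∘L adjoint (G (u t)))
        = (Ψ t - G (u t) ∘L adjoint (G (u t))) - (A ∘L Phat t + Phat t ∘L adjoint A) := by abel
    have hlin : ‖A ∘L Phat t + Phat t ∘L adjoint A‖ ≤ 2 * (q t * ‖Phat t‖) := by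
      refine (norm_add_le _ _).trans ?_
      have e1 := (opNorm_comp_le A (Phat t)).trans
        (mul_le_mul_of_nonneg_right hA (norm_nonneg _))
      have e2 := opNorm_comp_le (Phat t) (adjoint A)
      rw [LinearIsometryEquiv.norm_map] at e2
      have e3 := mul_le_mul_of_nonneg_left hA (norm_nonneg (Phat t))
      linarith
    have htri : ‖P t‖ ≤ ‖P t - Phat t‖ + ‖Phat t‖ := by
      simpa using norm_add_le (P t - Phat t) (Phat t)
    have := mul_le_mul_of_nonneg_left htri
      (mul_nonneg (by positivity : (0:ℝ) ≤ 2 * n) (hq0 t))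
    rw [hsplit]
    refine (norm_sub_le _ _).trans ?_
    linarith
  have hmean : ∀ t ∈ Set.Icc 0 t_f, ‖m t - mhat t‖ ≤ S * Real.exp I := by
    refine norm_le_integral_mul_exp_of_norm_deriv_le (hmi.sub hmhi)
      (hdiff hmi hmhi hm' hmh') hq hq0 hqS
      (fun s => mul_nonneg (hq0 s) (Real.sqrt_nonneg _)) fun t ht => ?_
    have := hμ t ht
    have e1 := norm_integral_sub_le (h1 t ht) (h2 t ht) (hP t ht) (hfi t ht) (hq0 t)
      fun x => hlip t x (m t)
    have e2 := hlip t (m t) (mhat t)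
    refine (norm_sub_le_norm_sub_add_norm_sub _ (f (m t) (u t)) _).trans ?_
    linarith
  have hQ : ∫ s in (0:ℝ)..t_f, q s * ‖P s‖
      ≤ I * ((2 * n + 2) * J * Real.exp (2 * n * I)) + J := by
    rw [hI, hJ, ← intervalIntegral.integral_mul_const, ← integral_add (hq.mul_const _) hqPh]
    refine integral_mono_on hT hqP ((hq.mul_const _).add hqPh) fun s hs => ?_
    have htri : ‖P s‖ ≤ ‖P s - Phat s‖ + ‖Phat s‖ := by
      simpa using norm_add_le (P s - Phat s) (Phat s)
    rw [← mul_add]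
    exact mul_le_mul_of_nonneg_left (htri.trans (by gcongr; exact hcov s hs)) (hq0 s)
  have hS2 : S ^ 2 ≤ I * (n * ∫ s in (0:ℝ)..t_f, q s * ‖P s‖) := by
    have hsq (s) : q s * √(n * ‖P s‖) ^ 2 = n * (q s * ‖P s‖) := by
      rw [Real.sq_sqrt (by positivity)]; ring
    have := sq_integral_mul_le (ν := volume.restrict (Set.Ioc 0 t_f)) hq0 hq.1 hqS.1
      (by simp_rw [hsq]; exact (hqP.const_mul _).1)
    simp_rw [hsq] at this
    rwa [← integral_of_le hT, ← integral_of_le hT, ← integral_of_le hT,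
      intervalIntegral.integral_const_mul] at this
  rw [Real.coe_toNNReal _ (by positivity), Real.coe_toNNReal _ hI0] at hα
  refine le_trans ?_ hα
  calc ‖m t₁ - mhat t₁‖ ^ 2 + ‖P t₂ - Phat t₂‖
      ≤ (S * Real.exp I) ^ 2 + (2 * n + 2) * J * Real.exp (2 * n * I) := by
        gcongr
        · exact hmean t₁ ht₁
        · exact hcov t₂ ht₂
    _ ≤ I * (n * (I * ((2 * n + 2) * J * Real.exp (2 * n * I)) + J)) * Real.exp I ^ 2
        + (2 * n + 2) * J * Real.exp (2 * n * I) := by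
        rw [mul_pow]
        gcongr
        exact hS2.trans (by gcongr)
    _ = _ := by ring
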